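/- Let A generate a C₀-group {U(t)} on a Banach space X satisfying the non-quasianalyticity condition, and x ∈ D(A^m). Then E_r(x,A) ≤ (m_m/r^m)·(M_U(1/r))^m·‖A^m x‖ for all r ≥ 1, where m_m is the constant from the abstract Jackson inequality. -/

import Mathlib

open Filter Topology MeasureTheory

variable {X : Type*} [NormedAddCommGroup X] [NormedSpace ℝ X] [CompleteSpace X]

/-- `M_U(t) = sup_{|τ| ≤ t} ‖U(τ)‖`. -/
noncomputable def groupBound (U : ℝ → X →L[ℝ] X) (t : ℝ) : ℝ :=
  sSup {a : ℝ | ∃ τ : ℝ, |τ| ≤ t ∧ a = ‖U τ‖}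

/-- `ω_k(t,x) = sup_{0 ≤ τ ≤ t} ‖(U(τ)-I)^k x‖`, the k-th modulus of continuity. -/
noncomputable def modulus (U : ℝ → X →L[ℝ] X) (k : ℕ) (t : ℝ) (x : X) : ℝ :=
  sSup {a : ℝ | ∃ τ : ℝ, 0 ≤ τ ∧ τ ≤ t ∧ a = ‖((U τ - 1) ^ k) x‖}

/-- `ω̃_k(t,x) = sup_{|τ| ≤ t} ‖(U(τ)-I)^k x‖`, the symmetric modulus of continuity. -/
noncomputable def symModulus (U : ℝ → X →L[ℝ] X) (k : ℕ) (t : ℝ) (x : X) : ℝ :=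
  sSup {a : ℝ | ∃ τ : ℝ, |τ| ≤ t ∧ a = ‖((U τ - 1) ^ k) x‖}

/-- `U` is a `C₀`-group of bounded operators. -/
structure IsC0Group (U : ℝ → X →L[ℝ] X) : Prop where
  map_zero : U 0 = 1
  map_add : ∀ s t : ℝ, U (s + t) = U s ∘L U t
  cont : ∀ x : X, Continuous fun t : ℝ => U t x

/-- The chain relation `A (xs n) = xs (n+1)` for the generator `A` of the group `U`,
expressed via `d/ds U(s) xs n = U(s) (xs (n+1))`. -/
def GenChain (U : ℝ → X →L[ℝ] X) (xs : ℕ → X) : Prop :=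
  ∀ (n : ℕ) (s : ℝ), HasDerivAt (fun t : ℝ => U t (xs n)) (U s (xs (n + 1))) s

/-- `y` is an entire vector of exponential type ≤ r for the generator of `U`:
`σ(y,A) = limsup ‖Aⁿy‖^{1/n} ≤ r`. -/
def ExpTypeLe (U : ℝ → X →L[ℝ] X) (y : X) (r : ℝ) : Prop :=
  ∃ xs : ℕ → X, xs 0 = y ∧ GenChain U xs ∧
    ∀ ρ : ℝ, r < ρ → ∃ c : ℝ, 0 < c ∧ ∀ n : ℕ, ‖xs n‖ ≤ c * ρ ^ n

/-- `E_r(x,A)`: the best approximation of `x` by exponential type entire vectors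
of type at most `r`. -/
noncomputable def bestApprox (U : ℝ → X →L[ℝ] X) (x : X) (r : ℝ) : ℝ :=
  sInf {d : ℝ | ∃ y : X, ExpTypeLe U y r ∧ d = ‖x - y‖}
open scoped ContDiff

/-- A smooth function all of whose derivatives satisfy `|f⁽ⁿ⁾(t)| ≤ bⁿ φ(t)`. -/
structure DerivMajorant (f : ℝ → ℝ) (b : ℝ) (φ : ℝ → ℝ) : Prop where
  smooth : ContDiff ℝ ∞ f
  bound : ∀ n t, |iteratedDeriv n f t| ≤ b ^ n * φ t

/-- A sequence of functions, each the derivative of its predecessor, consists of the iterated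
derivatives of its first member. -/
theorem contDiff_of_derivative_sequence {g : ℕ → ℝ → ℝ}
    (hg : ∀ n t, HasDerivAt (g n) (g (n + 1) t) t) :
    ContDiff ℝ ∞ (g 0) ∧ ∀ n, iteratedDeriv n (g 0) = g n := by
  have h : ∀ n, iteratedDeriv n (g 0) = g n := by
    intro n
    induction n with
    | zero => simp
    | succ n ih =>
      rw [iteratedDeriv_succ, ih]
      exact funext fun t => (hg n t).deriv
  refine ⟨contDiff_of_differentiable_iteratedDeriv fun n _ => ?_, h⟩
  rw [h n]
  exact fun t => (hg n t).differentiableAt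

theorem hasDerivAt_iteratedDeriv {f : ℝ → ℝ} (hf : ContDiff ℝ ∞ f) (n : ℕ) (t : ℝ) :
    HasDerivAt (iteratedDeriv n f) (iteratedDeriv (n + 1) f t) t := by
  rw [iteratedDeriv_succ]
  exact (hf.differentiable_iteratedDeriv n (by exact_mod_cast ENat.natCast_lt_top n) t).hasDerivAt

namespace DerivMajorant

variable {f g : ℝ → ℝ} {b c : ℝ} {φ ψ : ℝ → ℝ}

theorem majorant_nonneg (hf : DerivMajorant f b φ) (t : ℝ) : 0 ≤ φ t := by
  simpa using (abs_nonneg _).trans (hf.bound 0 t)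

theorem mono (hf : DerivMajorant f b φ) (hb : 0 ≤ b) (hbc : b ≤ c) (hφ : ∀ t, φ t ≤ ψ t) :
    DerivMajorant f c ψ :=
  ⟨hf.smooth, fun n t => (hf.bound n t).trans <|
    mul_le_mul (pow_le_pow_left₀ hb hbc n) (hφ t) (hf.majorant_nonneg t)
      (pow_nonneg (hb.trans hbc) n)⟩

theorem const_one : DerivMajorant (fun _ => 1) 0 (fun _ => 1) := by
  refine ⟨contDiff_const, fun n t => ?_⟩
  rcases n with _ | n
  · simp
  · simp [iteratedDeriv_const]

theorem mul (hf : DerivMajorant f b φ) (hg : DerivMajorant g c ψ) (hb : 0 ≤ b) :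
    DerivMajorant (fun t => f t * g t) (b + c) (fun t => φ t * ψ t) := by
  refine ⟨hf.smooth.mul hg.smooth, fun n t => ?_⟩
  have h := norm_iteratedFDeriv_mul_le hf.smooth hg.smooth t (n := n)
    (by exact_mod_cast (ENat.natCast_lt_top n).le)
  simp only [norm_iteratedFDeriv_eq_norm_iteratedDeriv, Real.norm_eq_abs] at h
  refine h.trans ?_
  rw [add_pow, Finset.sum_mul]
  refine Finset.sum_le_sum fun i _ => ?_
  calc (n.choose i : ℝ) * |iteratedDeriv i f t| * |iteratedDeriv (n - i) g t|
      ≤ (n.choose i : ℝ) * (b ^ i * φ t) * (c ^ (n - i) * ψ t) := by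
        have := hf.majorant_nonneg t
        gcongr
        · exact hf.bound i t
        · exact hg.bound (n - i) t
    _ = b ^ i * c ^ (n - i) * n.choose i * (φ t * ψ t) := by ring

theorem pow (hf : DerivMajorant f b φ) (hb : 0 ≤ b) (k : ℕ) :
    DerivMajorant (fun t => f t ^ k) (k * b) (fun t => φ t ^ k) := by
  induction k with
  | zero => simpa using const_one
  | succ k ih =>
    have := ih.mul hf (by positivity)
    simp only [pow_succ, Nat.cast_succ, add_mul, one_mul]
    exact this

theorem prod {f : ℕ → ℝ → ℝ} {b : ℕ → ℝ} {φ : ℕ → ℝ → ℝ} (hb : ∀ k, 0 ≤ b k)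
    (hf : ∀ k, DerivMajorant (f k) (b k) (φ k)) (N : ℕ) :
    DerivMajorant (fun t => ∏ k ∈ Finset.range N, f k t) (∑ k ∈ Finset.range N, b k)
      (fun t => ∏ k ∈ Finset.range N, φ k t) := by
  induction N with
  | zero => simpa using const_one
  | succ N ih =>
    simp only [Finset.prod_range_succ, Finset.sum_range_succ]
    exact ih.mul (hf N) (Finset.sum_nonneg fun k _ => hb k)

theorem comp_mul (hf : DerivMajorant f b φ) {a : ℝ} (ha : 0 ≤ a) :
    DerivMajorant (fun t => f (a * t)) (a * b) (fun t => φ (a * t)) := by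
  refine ⟨hf.smooth.comp (by fun_prop), fun n t => ?_⟩
  rw [iteratedDeriv_comp_const_mul (hf.smooth.of_le (by exact_mod_cast (ENat.natCast_lt_top n).le)),
    abs_mul, abs_of_nonneg (pow_nonneg ha n), mul_pow, mul_assoc]
  exact mul_le_mul_of_nonneg_left (hf.bound n _) (pow_nonneg ha n)

theorem taylor_remainder (hf : DerivMajorant f 1 fun _ => 1) (n : ℕ) (t h : ℝ) :
    |iteratedDeriv n f (t + h) - iteratedDeriv n f t - h * iteratedDeriv (n + 1) f t| ≤ h ^ 2 := by
  have lip : ∀ u, |iteratedDeriv (n + 1) f u - iteratedDeriv (n + 1) f t| ≤ |u - t| := by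
    intro u
    have := convex_univ.norm_image_sub_le_of_norm_hasDerivWithin_le (C := 1)
      (fun v _ => (hasDerivAt_iteratedDeriv hf.smooth (n + 1) v).hasDerivWithinAt)
      (fun v _ => by simpa using hf.bound (n + 1 + 1) v) (Set.mem_univ t) (Set.mem_univ u)
    simpa using this
  have := (convex_uIcc t (t + h)).norm_image_sub_le_of_norm_hasDerivWithin_le (C := |h|)
    (f := fun u => iteratedDeriv n f u - u * iteratedDeriv (n + 1) f t)
    (f' := fun u => iteratedDeriv (n + 1) f u - 1 * iteratedDeriv (n + 1) f t)
    (fun v _ => ((hasDerivAt_iteratedDeriv hf.smooth n v).sub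
      ((hasDerivAt_id v).mul_const _)).hasDerivWithinAt)
    (fun v hv => by
      rw [one_mul]
      refine (lip v).trans ?_
      simpa using Set.abs_sub_left_of_mem_uIcc hv) Set.left_mem_uIcc Set.right_mem_uIcc
  calc _ = ‖iteratedDeriv n f (t + h) - (t + h) * iteratedDeriv (n + 1) f t -
          (iteratedDeriv n f t - t * iteratedDeriv (n + 1) f t)‖ := by
        rw [Real.norm_eq_abs]; congr 1; ring
    _ ≤ |h| * ‖t + h - t‖ := this
    _ = h ^ 2 := by rw [add_sub_cancel_left, Real.norm_eq_abs, ← sq, sq_abs]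

/-- A sequence of functions of type one, bounded by one together with their derivatives, has a
limit point inheriting every pointwise bound on the derivatives. -/
theorem exists_limit {f : ℕ → ℝ → ℝ} (hf : ∀ N, DerivMajorant (f N) 1 fun _ => 1)
    (h0 : ∀ N, f N 0 = 1) :
    ∃ g : ℝ → ℝ, ContDiff ℝ ∞ g ∧ g 0 = 1 ∧ ∀ n t a,
      (∀ᶠ N in atTop, |iteratedDeriv n (f N) t| ≤ a) → |iteratedDeriv n g t| ≤ a := by
  let 𝒰 : Ultrafilter ℕ := Filter.hyperfilter ℕ
  have hlim : ∀ n t, ∃ l, Tendsto (fun N => iteratedDeriv n (f N) t) 𝒰 (𝓝 l) := by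
    intro n t
    obtain ⟨l, -, hl⟩ := isCompact_iff_ultrafilter_le_nhds'.1
      (isCompact_Icc (a := (-1 : ℝ)) (b := 1)) (𝒰.map fun N => iteratedDeriv n (f N) t)
      (Ultrafilter.mem_map.2 <| Filter.univ_mem' fun N =>
        abs_le.1 (by simpa using (hf N).bound n t))
    exact ⟨l, hl⟩
  choose g hg using hlim
  have hderiv : ∀ n t, HasDerivAt (g n) (g (n + 1) t) t := by
    intro n t
    have rem : ∀ h, ‖g n (t + h) - g n t - h • g (n + 1) t‖ ≤ 1 * ‖h ^ 2‖ := by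
      intro h
      have hT := (((hg n (t + h)).sub (hg n t)).sub ((hg (n + 1) t).const_mul h)).abs
      simpa using le_of_tendsto hT
        (Filter.Eventually.of_forall fun N => (hf N).taylor_remainder n t h)
    rw [hasDerivAt_iff_isLittleO_nhds_zero]
    refine (Asymptotics.IsBigO.of_bound 1 (Filter.Eventually.of_forall rem)).trans_isLittleO ?_
    simpa using Asymptotics.isLittleO_pow_id (one_lt_two)
  obtain ⟨hs, hi⟩ := contDiff_of_derivative_sequence hderiv
  have hle : (𝒰 : Filter ℕ) ≤ atTop := Nat.hyperfilter_le_atTop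
  refine ⟨g 0, hs, ?_, fun n t a ha => ?_⟩
  · refine tendsto_nhds_unique (hg 0 0) ?_
    simp [h0]
  · rw [hi]
    exact le_of_tendsto (hg n t).abs (ha.filter_mono hle)

end DerivMajorant

/-- The derivatives of `∫₀¹ cos (t ξ) dξ`. -/
noncomputable def sincDeriv (n : ℕ) (t : ℝ) : ℝ :=
  ∫ ξ in (0 : ℝ)..1, ξ ^ n * Real.cos (t * ξ + n * (Real.pi / 2))

theorem hasDerivAt_sincDeriv (n : ℕ) (t : ℝ) :
    HasDerivAt (sincDeriv n) (sincDeriv (n + 1) t) t := by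
  have hshift : ∀ s ξ : ℝ, Real.cos (s * ξ + (n + 1 : ℕ) * (Real.pi / 2)) =
      -Real.sin (s * ξ + n * (Real.pi / 2)) := by
    intro s ξ
    rw [← Real.cos_add_pi_div_two]
    push_cast
    ring_nf
  refine (intervalIntegral.hasDerivAt_integral_of_dominated_loc_of_deriv_le (μ := volume)
    (F := fun s ξ => ξ ^ n * Real.cos (s * ξ + n * (Real.pi / 2)))
    (F' := fun s ξ => ξ ^ (n + 1) * Real.cos (s * ξ + (n + 1 : ℕ) * (Real.pi / 2)))
    (bound := fun _ => 1) Filter.univ_mem ?_ ?_ ?_ ?_ ?_ ?_).2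
  · exact Filter.Eventually.of_forall fun s => Continuous.aestronglyMeasurable (by fun_prop)
  · exact Continuous.intervalIntegrable (by fun_prop) _ _
  · exact Continuous.aestronglyMeasurable (by fun_prop)
  · refine Filter.Eventually.of_forall fun ξ hξ s _ => ?_
    rw [Set.uIoc_of_le zero_le_one] at hξ
    rw [norm_mul, norm_pow, Real.norm_eq_abs, Real.norm_eq_abs, abs_of_pos hξ.1]
    exact mul_le_one₀ (pow_le_one₀ hξ.1.le hξ.2) (abs_nonneg _) (Real.abs_cos_le_one _)
  · exact intervalIntegrable_const
  · refine Filter.Eventually.of_forall fun ξ _ s _ => ?_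
    rw [hshift, pow_succ]
    have := (((hasDerivAt_id s).mul_const ξ).add_const (n * (Real.pi / 2))).cos.const_mul (ξ ^ n)
    refine this.congr_deriv ?_
    simp only [id_eq]
    ring

theorem abs_sincDeriv_le_one (n : ℕ) (t : ℝ) : |sincDeriv n t| ≤ 1 := by
  have := intervalIntegral.norm_integral_le_of_norm_le_const (a := (0 : ℝ)) (b := 1) (C := 1)
    (f := fun ξ => ξ ^ n * Real.cos (t * ξ + n * (Real.pi / 2))) (fun ξ hξ => by
      rw [Set.uIoc_of_le zero_le_one] at hξ
      rw [norm_mul, norm_pow, Real.norm_eq_abs, Real.norm_eq_abs, abs_of_pos hξ.1]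
      exact mul_le_one₀ (pow_le_one₀ hξ.1.le hξ.2) (abs_nonneg _) (Real.abs_cos_le_one _))
  simpa [sincDeriv] using this

theorem abs_mul_sincDeriv_le_two (n : ℕ) (t : ℝ) : |t| * |sincDeriv n t| ≤ 2 := by
  have hparts : ∀ ξ ∈ Set.uIcc (0 : ℝ) 1,
      HasDerivAt (fun ξ => ξ ^ n * Real.sin (t * ξ + n * (Real.pi / 2)))
        (n * ξ ^ (n - 1) * Real.sin (t * ξ + n * (Real.pi / 2)) +
          t * (ξ ^ n * Real.cos (t * ξ + n * (Real.pi / 2)))) ξ := by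
    intro ξ _
    have := (hasDerivAt_pow n ξ).mul
      (((hasDerivAt_id ξ).const_mul t).add_const (n * (Real.pi / 2))).sin
    refine this.congr_deriv ?_
    simp only [id_eq]
    ring
  have hI := intervalIntegral.integral_eq_sub_of_hasDerivAt hparts
    (Continuous.intervalIntegrable (by fun_prop) _ _)
  rw [intervalIntegral.integral_add (Continuous.intervalIntegrable (by fun_prop) _ _)
    (Continuous.intervalIntegrable (by fun_prop) _ _), intervalIntegral.integral_const_mul] at hI
  have hend : (0 : ℝ) ^ n * Real.sin (t * 0 + n * (Real.pi / 2)) = 0 := by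
    rcases n with _ | n <;> simp
  rw [hend, one_pow, one_mul, mul_one, sub_zero] at hI
  have hfirst : |∫ ξ in (0 : ℝ)..1, n * ξ ^ (n - 1) * Real.sin (t * ξ + n * (Real.pi / 2))| ≤ 1 := by
    have hb := intervalIntegral.norm_integral_le_of_norm_le (a := (0 : ℝ)) (b := 1) (μ := volume)
      (f := fun ξ => n * ξ ^ (n - 1) * Real.sin (t * ξ + n * (Real.pi / 2)))
      (g := fun ξ => n * ξ ^ (n - 1)) zero_le_one
      (Filter.Eventually.of_forall fun ξ hξ => by
        have : (0 : ℝ) ≤ n * ξ ^ (n - 1) := mul_nonneg n.cast_nonneg (pow_nonneg hξ.1.le _)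
        rw [norm_mul, Real.norm_of_nonneg this]
        exact mul_le_of_le_one_right this (Real.abs_sin_le_one _))
      (Continuous.intervalIntegrable (by fun_prop) _ _)
    refine hb.trans ?_
    rw [intervalIntegral.integral_eq_sub_of_hasDerivAt (fun ξ _ => hasDerivAt_pow n ξ)
      (Continuous.intervalIntegrable (by fun_prop) _ _)]
    simp
  have hsin := Real.abs_sin_le_one (t + n * (Real.pi / 2))
  have key : t * sincDeriv n t = Real.sin (t + n * (Real.pi / 2)) -
      ∫ ξ in (0 : ℝ)..1, n * ξ ^ (n - 1) * Real.sin (t * ξ + n * (Real.pi / 2)) := by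
    rw [← hI, sincDeriv]
    ring
  rw [← abs_mul, key]
  exact (abs_sub _ _).trans (by linarith)

theorem derivMajorant_sincDeriv : DerivMajorant (sincDeriv 0) 1
    (fun t => if 2 * Real.exp 1 ≤ |t| then Real.exp (-1) else 1) := by
  obtain ⟨hs, hi⟩ := contDiff_of_derivative_sequence hasDerivAt_sincDeriv
  refine ⟨hs, fun n t => ?_⟩
  rw [hi, one_pow, one_mul]
  split_ifs with ht
  · have h2 := (mul_le_mul_of_nonneg_right ht (abs_nonneg (sincDeriv n t))).trans
      (abs_mul_sincDeriv_le_two n t)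
    rw [Real.exp_neg, inv_eq_one_div, le_div_iff₀ (Real.exp_pos 1)]
    linarith
  · exact abs_sincDeriv_le_one n t

theorem sincDeriv_zero_zero : sincDeriv 0 0 = 1 := by simp [sincDeriv]

/-- A smooth function, of type one together with all its derivatives, that decays at least like
`exp (-νₖ)` outside `[-4ᵏ, 4ᵏ]`. -/
theorem exists_rapidly_decreasing_of_summable {ν : ℕ → ℕ}
    (hν : Summable fun k => (ν k : ℝ) * (1 / 4) ^ k) :
    ∃ (k₀ : ℕ) (g : ℝ → ℝ), ContDiff ℝ ∞ g ∧ g 0 = 1 ∧ (∀ n t, |iteratedDeriv n g t| ≤ 1) ∧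
      ∀ k, k₀ ≤ k → ∀ t : ℝ, 4 ^ k ≤ |t| → ∀ n, |iteratedDeriv n g t| ≤ Real.exp (-ν k) := by
  let β : ℕ → ℝ := fun k => 2 * Real.exp 1 * (1 / 4) ^ k
  have hβ0 : ∀ k, 0 ≤ β k := fun k => by positivity
  have hβ : Summable fun k => (ν k : ℝ) * β k :=
    (hν.mul_left (2 * Real.exp 1)).congr fun k => by simp only [β]; ring
  obtain ⟨k₀, hk₀⟩ : ∃ k₀, ∑' k, (ν (k + k₀) : ℝ) * β (k + k₀) < 1 :=
    ((tendsto_sum_nat_add fun k => (ν k : ℝ) * β k).eventually_lt_const one_pos).exists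
  let φ : ℕ → ℝ → ℝ := fun k t =>
    (if 2 * Real.exp 1 ≤ |β k * t| then Real.exp (-1) else 1) ^ ν k
  have hφ0 : ∀ k t, 0 ≤ φ k t := fun k t => by
    simp only [φ]; split_ifs <;> positivity
  have hφ1 : ∀ k t, φ k t ≤ 1 := fun k t => by
    simp only [φ]
    split_ifs
    · exact pow_le_one₀ (Real.exp_pos _).le (Real.exp_le_one_iff.2 (by norm_num))
    · simp
  have hφ : ∀ k (t : ℝ), 4 ^ k ≤ |t| → φ k t = Real.exp (-ν k) := fun k t ht => by
    have h : 2 * Real.exp 1 ≤ |β k * t| := by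
      rw [abs_mul, abs_of_nonneg (hβ0 k)]
      calc 2 * Real.exp 1 = β k * 4 ^ k := by
            simp only [β]
            rw [mul_assoc, ← mul_pow]
            norm_num
        _ ≤ β k * |t| := mul_le_mul_of_nonneg_left ht (hβ0 k)
    simp only [φ, if_pos h]
    rw [← Real.exp_nat_mul]
    congr 1
    ring
  have hfac : ∀ k, DerivMajorant (fun t => sincDeriv 0 (β k * t) ^ ν k) (ν k * β k) (φ k) := by
    intro k
    have := (derivMajorant_sincDeriv.comp_mul (hβ0 k)).pow (by simpa using hβ0 k) (ν k)
    rwa [mul_one] at this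
  have hprod := fun N => DerivMajorant.prod
    (f := fun k t => sincDeriv 0 (β (k + k₀) * t) ^ ν (k + k₀))
    (fun k => mul_nonneg (Nat.cast_nonneg (ν (k + k₀))) (hβ0 (k + k₀)))
    (fun k => hfac (k + k₀)) N
  have htype : ∀ N, ∑ k ∈ Finset.range N, (ν (k + k₀) : ℝ) * β (k + k₀) ≤ 1 := fun N =>
    (((summable_nat_add_iff k₀).2 hβ).sum_le_tsum _
      fun k _ => mul_nonneg (Nat.cast_nonneg _) (hβ0 _)).trans hk₀.le
  have htype0 : ∀ N, 0 ≤ ∑ k ∈ Finset.range N, (ν (k + k₀) : ℝ) * β (k + k₀) := fun N =>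
    Finset.sum_nonneg fun k _ => mul_nonneg (Nat.cast_nonneg _) (hβ0 _)
  have hone : ∀ N, DerivMajorant
      (fun t => ∏ k ∈ Finset.range N, sincDeriv 0 (β (k + k₀) * t) ^ ν (k + k₀)) 1 fun _ => 1 :=
    fun N => (hprod N).mono (htype0 N) (htype N) fun t =>
      Finset.prod_le_one (fun k _ => hφ0 _ t) fun k _ => hφ1 _ t
  obtain ⟨g, hgs, hg0, hg⟩ := DerivMajorant.exists_limit hone
    (by intro N; simp [sincDeriv_zero_zero])
  refine ⟨k₀, g, hgs, hg0, fun n t => ?_, fun k hk t ht n => ?_⟩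
  · exact hg n t 1 (Filter.Eventually.of_forall fun N => by simpa using (hone N).bound n t)
  · refine hg n t _ ((eventually_gt_atTop (k - k₀)).mono fun N hN => ?_)
    have hle : ∏ k ∈ Finset.range N, φ (k + k₀) t ≤ Real.exp (-ν k) := by
      rw [← hφ k t ht, ← Finset.mul_prod_erase _ _ (Finset.mem_range.2 hN), Nat.sub_add_cancel hk]
      exact mul_le_of_le_one_right (hφ0 k t)
        (Finset.prod_le_one (fun k _ => hφ0 _ t) fun k _ => hφ1 _ t)
    have := (((hprod N).mono (htype0 N) (htype N) fun _ => le_rfl).bound n t)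
    rw [one_pow, one_mul] at this
    exact this.trans hle

theorem summable_natCeil_log_weight {M : ℝ → ℝ} (hM1 : ∀ t, 0 ≤ t → 1 ≤ M t)
    (hM : Summable fun k : ℕ => Real.log (M (4 ^ k)) * (1 / 4) ^ k) (m : ℕ) :
    Summable fun k : ℕ => (⌈Real.log ((1 + (4 ^ (k + 2)) ^ 2) *
      ((1 + 4 ^ (k + 2)) * M (4 ^ (k + 2))) ^ m)⌉₊ : ℝ) * (1 / 4) ^ k := by
  have hlin : Summable fun k : ℕ => (k : ℝ) * (1 / 4) ^ k := by
    simpa using summable_pow_mul_geometric_of_norm_lt_one 1 (r := (1 / 4 : ℝ)) (by norm_num)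
  have hgeo : Summable fun k : ℕ => (1 / 4 : ℝ) ^ k :=
    summable_geometric_of_lt_one (by norm_num) (by norm_num)
  have hshift := (((summable_nat_add_iff 2).2 hM).mul_left (16 * (m : ℝ)))
  refine Summable.of_nonneg_of_le (fun k => by positivity) (fun k => ?_)
    (((hlin.mul_left ((2 + m) * Real.log 4)).add
      (hgeo.mul_left ((5 + 3 * m) * Real.log 4 + 1))).add hshift)
  have hs : (1 : ℝ) ≤ 4 ^ (k + 2) := one_le_pow₀ (by norm_num)
  have hMs := hM1 (4 ^ (k + 2)) (by positivity)
  have hpos : 0 < 1 + ((4 : ℝ) ^ (k + 2)) ^ 2 := by positivity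
  have hsq : Real.log (1 + ((4 : ℝ) ^ (k + 2)) ^ 2) ≤ (2 * k + 5) * Real.log 4 := by
    rw [show ((2 : ℝ) * k + 5) = ((2 * k + 5 : ℕ) : ℝ) by push_cast; ring, ← Real.log_pow]
    refine Real.log_le_log hpos ?_
    rw [show (4 : ℝ) ^ (2 * k + 5) = 4 * (4 ^ (k + 2)) ^ 2 by ring]
    nlinarith
  have hlog1 : Real.log (1 + (4 : ℝ) ^ (k + 2)) ≤ (k + 3) * Real.log 4 := by
    rw [show ((k : ℝ) + 3) = ((k + 3 : ℕ) : ℝ) by push_cast; ring, ← Real.log_pow]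
    refine Real.log_le_log (by positivity) ?_
    rw [show (4 : ℝ) ^ (k + 3) = 4 * 4 ^ (k + 2) by ring]
    linarith
  have hW : Real.log ((1 + ((4 : ℝ) ^ (k + 2)) ^ 2) *
      ((1 + 4 ^ (k + 2)) * M (4 ^ (k + 2))) ^ m) ≤
      (2 * k + 5) * Real.log 4 + m * ((k + 3) * Real.log 4 + Real.log (M (4 ^ (k + 2)))) := by
    rw [Real.log_mul hpos.ne' (by positivity), Real.log_pow,
      Real.log_mul (by positivity) (by positivity)]
    gcongr
  have hW0 : 0 ≤ Real.log ((1 + ((4 : ℝ) ^ (k + 2)) ^ 2) *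
      ((1 + 4 ^ (k + 2)) * M (4 ^ (k + 2))) ^ m) := by
    refine Real.log_nonneg (one_le_mul_of_one_le_of_one_le (by nlinarith) (one_le_pow₀ ?_))
    exact one_le_mul_of_one_le_of_one_le (by linarith) hMs
  calc _ ≤ ((2 * k + 5) * Real.log 4 +
        m * ((k + 3) * Real.log 4 + Real.log (M (4 ^ (k + 2)))) + 1) * (1 / 4 : ℝ) ^ k := by
        gcongr
        exact (Nat.ceil_lt_add_one hW0).le.trans (by linarith)
    _ = _ := by
        rw [pow_add (1 / 4 : ℝ) k 2]
        ring

/-- A nonnegative kernel of exponential type one, with integral one, that is integrable with all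
its derivatives against powers of a non-quasianalytic weight. -/
theorem exists_kernel {M : ℝ → ℝ} (hM1 : ∀ t, 0 ≤ t → 1 ≤ M t)
    (hmono : ∀ s t, 0 ≤ s → s ≤ t → M s ≤ M t)
    (hM : Summable fun k : ℕ => Real.log (M (4 ^ k)) * (1 / 4) ^ k) (m : ℕ) :
    ∃ (K : ℝ → ℝ) (C : ℝ), ContDiff ℝ ∞ K ∧ (∀ t, 0 ≤ K t) ∧ ∫ t, K t = 1 ∧ 0 < C ∧
      ∀ n t, |iteratedDeriv n K t| * ((1 + |t|) * M |t|) ^ m ≤ C * (1 + t ^ 2)⁻¹ := by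
  let W : ℝ → ℝ := fun s => (1 + s ^ 2) * ((1 + s) * M s) ^ m
  have hW1 : ∀ s, 0 ≤ s → 1 ≤ W s := fun s hs =>
    one_le_mul_of_one_le_of_one_le (by nlinarith)
      (one_le_pow₀ (one_le_mul_of_one_le_of_one_le (by linarith) (hM1 s hs)))
  have hWmono : ∀ s t, 0 ≤ s → s ≤ t → W s ≤ W t := by
    intro s t hs hst
    have := hM1 s hs
    have := hmono s t hs hst
    have ht : 0 ≤ t := hs.trans hst
    simp only [W]
    gcongr
  obtain ⟨k₀, g, hgs, hg0, hg1, hg⟩ :=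
    exists_rapidly_decreasing_of_summable (summable_natCeil_log_weight hM1 hM m)
  set D : ℝ := W (4 ^ (k₀ + 2)) with hD
  have hD1 : 1 ≤ D := hW1 _ (by positivity)
  have hWpos : ∀ s, 0 ≤ s → 0 < W s := fun s hs => one_pos.trans_le (hW1 s hs)
  have hgW : ∀ n t, |iteratedDeriv n g t| ≤ D / W (2 * |t|) := by
    intro n t
    have h2t : 0 ≤ 2 * |t| := by positivity
    rcases lt_or_ge |t| (4 ^ k₀) with ht | ht
    · refine (hg1 n t).trans ((one_le_div (hWpos _ h2t)).2 (hWmono _ _ h2t ?_))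
      rw [pow_add]
      linarith
    · obtain ⟨k, hk, hk'⟩ := exists_nat_pow_near ((one_le_pow₀ (by norm_num)).trans ht)
        (by norm_num : (1 : ℝ) < 4)
      have hkk : k₀ ≤ k := Nat.lt_succ_iff.1
        ((pow_lt_pow_iff_right₀ (by norm_num : (1 : ℝ) < 4)).1 (ht.trans_lt hk'))
      refine (hg k hkk t hk n).trans ?_
      rw [le_div_iff₀ (hWpos _ h2t)]
      have hle : W (2 * |t|) ≤ W (4 ^ (k + 2)) := by
        refine hWmono _ _ h2t ?_
        rw [pow_succ] at hk'
        rw [pow_add]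
        linarith
      have hexp : W (4 ^ (k + 2)) ≤ Real.exp ⌈Real.log (W (4 ^ (k + 2)))⌉₊ := by
        rw [← Real.log_le_iff_le_exp (hWpos _ (by positivity))]
        exact Nat.le_ceil _
      calc _ ≤ Real.exp (-⌈Real.log (W (4 ^ (k + 2)))⌉₊) *
            Real.exp ⌈Real.log (W (4 ^ (k + 2)))⌉₊ := by
            gcongr
            exact hle.trans hexp
        _ = 1 := by rw [← Real.exp_add]; simp
        _ ≤ D := hD1
  have hgm : DerivMajorant g 1 (fun t => min 1 (D / W (2 * |t|))) :=
    ⟨hgs, fun n t => by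
      rw [one_pow, one_mul]
      exact le_min (hg1 n t) (hgW n t)⟩
  have hhalf := hgm.comp_mul (a := 1 / 2) (by norm_num)
  have hsq : DerivMajorant (fun t => g (1 / 2 * t) * g (1 / 2 * t)) 1 (fun t => D / W |t|) := by
    refine (hhalf.mul hhalf (by norm_num)).mono (by norm_num) (by norm_num) fun t => ?_
    have h2 : 2 * |1 / 2 * t| = |t| := by
      rw [abs_mul, abs_of_pos (by norm_num : (0 : ℝ) < 1 / 2)]
      ring
    have hq : 0 ≤ D / W |t| := div_nonneg (by linarith) (hWpos _ (abs_nonneg t)).le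
    rw [h2]
    calc _ ≤ 1 * (D / W |t|) := by
          gcongr
          · exact min_le_left _ _
          · exact min_le_right _ _
      _ = _ := one_mul _
  set K₀ : ℝ → ℝ := fun t => g (1 / 2 * t) * g (1 / 2 * t) with hK₀
  have hbound : ∀ n t, |iteratedDeriv n K₀ t| * ((1 + |t|) * M |t|) ^ m ≤ D * (1 + t ^ 2)⁻¹ := by
    intro n t
    have h := hsq.bound n t
    rw [one_pow, one_mul, le_div_iff₀ (hWpos _ (abs_nonneg t))] at h
    simp only [W, sq_abs] at h
    rw [← div_eq_mul_inv, le_div_iff₀ (by positivity)]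
    linarith
  have hnonneg : ∀ t, 0 ≤ K₀ t := fun t => mul_self_nonneg _
  have hK₀i : Integrable K₀ := by
    refine (integrable_inv_one_add_sq.const_mul D).mono'
      hsq.smooth.continuous.aestronglyMeasurable (Filter.Eventually.of_forall fun t => ?_)
    refine le_trans ?_ (hbound 0 t)
    rw [iteratedDeriv_zero, Real.norm_eq_abs]
    refine le_mul_of_one_le_right (abs_nonneg _) (one_le_pow₀ ?_)
    exact one_le_mul_of_one_le_of_one_le (by linarith [abs_nonneg t]) (hM1 _ (abs_nonneg t))
  have hpos : 0 < ∫ t, K₀ t :=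
    integral_pos_of_integrable_nonneg_nonzero (x := 0) hsq.smooth.continuous hK₀i hnonneg
      (by simp [hK₀, hg0])
  refine ⟨fun t => (∫ t, K₀ t)⁻¹ * K₀ t, (∫ t, K₀ t)⁻¹ * D, contDiff_const.mul hsq.smooth,
    fun t => mul_nonneg (inv_nonneg.2 hpos.le) (hnonneg t), ?_, by positivity, fun n t => ?_⟩
  · rw [integral_const_mul, inv_mul_cancel₀ hpos.ne']
  · rw [iteratedDeriv_const_mul_field, abs_mul, abs_of_pos (inv_pos.2 hpos), mul_assoc, mul_assoc]
    exact mul_le_mul_of_nonneg_left (hbound n t) (inv_pos.2 hpos).le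

set_option linter.unusedSectionVars false

namespace IsC0Group

variable {U : ℝ → X →L[ℝ] X}

theorem exists_norm_le (hU : IsC0Group U) (T : ℝ) : ∃ C, ∀ τ : ℝ, |τ| ≤ T → ‖U τ‖ ≤ C := by
  obtain ⟨C, hC⟩ := banach_steinhaus (g := fun τ : Set.Icc (-T) T => U τ) fun x => by
    obtain ⟨C, hC⟩ := isCompact_Icc.exists_bound_of_continuousOn (hU.cont x).continuousOn
    exact ⟨C, fun τ => hC τ τ.2⟩
  exact ⟨C, fun τ hτ => hC ⟨τ, abs_le.1 hτ⟩⟩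

theorem norm_le_groupBound (hU : IsC0Group U) {τ T : ℝ} (h : |τ| ≤ T) :
    ‖U τ‖ ≤ groupBound U T := by
  obtain ⟨C, hC⟩ := hU.exists_norm_le T
  refine le_csSup ⟨C, ?_⟩ ⟨τ, h, rfl⟩
  rintro _ ⟨σ, hσ, rfl⟩
  exact hC σ hσ

theorem groupBound_le {T C : ℝ} (hT : 0 ≤ T) (h : ∀ τ : ℝ, |τ| ≤ T → ‖U τ‖ ≤ C) :
    groupBound U T ≤ C := by
  refine csSup_le ⟨‖U 0‖, 0, by simpa using hT, rfl⟩ ?_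
  rintro _ ⟨σ, hσ, rfl⟩
  exact h σ hσ

theorem groupBound_mono (hU : IsC0Group U) {S T : ℝ} (hS : 0 ≤ S) (hST : S ≤ T) :
    groupBound U S ≤ groupBound U T :=
  groupBound_le hS fun _ hτ => hU.norm_le_groupBound (hτ.trans hST)

theorem one_le_groupBound [Nontrivial X] (hU : IsC0Group U) {T : ℝ} (hT : 0 ≤ T) :
    1 ≤ groupBound U T := by
  have := hU.norm_le_groupBound (τ := 0) (by simpa using hT)
  rwa [hU.map_zero, norm_one] at this

theorem map_add_mul (hU : IsC0Group U) (s t : ℝ) : U (s + t) = U s * U t := hU.map_add s t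

theorem map_nat_mul (hU : IsC0Group U) (j : ℕ) (t : ℝ) : U (j * t) = U t ^ j := by
  induction j with
  | zero => simp [hU.map_zero]
  | succ j ih => rw [Nat.cast_succ, add_mul, one_mul, hU.map_add_mul, ih, pow_succ]

theorem commute (hU : IsC0Group U) (s t : ℝ) : Commute (U s) (U t) := by
  rw [Commute, SemiconjBy, ← hU.map_add_mul, ← hU.map_add_mul, add_comm]

theorem norm_pos [Nontrivial X] (hU : IsC0Group U) (t : ℝ) : 0 < ‖U t‖ := by
  refine norm_pos_iff.2 fun h => ?_
  have := hU.map_add_mul t (-t)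
  rw [h, zero_mul, add_neg_cancel, hU.map_zero] at this
  exact one_ne_zero this

theorem log_norm_add_le [Nontrivial X] (hU : IsC0Group U) (s t : ℝ) :
    Real.log ‖U (s + t)‖ ≤ Real.log ‖U s‖ + Real.log ‖U t‖ := by
  rw [← Real.log_mul (hU.norm_pos s).ne' (hU.norm_pos t).ne', hU.map_add_mul]
  refine Real.log_le_log ?_ (norm_mul_le _ _)
  rw [← hU.map_add_mul]
  exact hU.norm_pos _

theorem log_norm_le_integral_annulus [Nontrivial X] (hU : IsC0Group U)
    (hqa : Integrable (fun t : ℝ => Real.log ‖U t‖ / (1 + t ^ 2))) {s T : ℝ} (hT : 1 ≤ T)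
    (hs : |s| ≤ T) :
    Real.log ‖U s‖ ≤
      34 * T * ∫ v in {v : ℝ | T ≤ |v| ∧ |v| < 4 * T}, ‖Real.log ‖U v‖ / (1 + v ^ 2)‖ := by
  set h : ℝ → ℝ := fun v => ‖Real.log ‖U v‖ / (1 + v ^ 2)‖ with hh
  have hinteg : Integrable h := hqa.norm
  have habs := abs_le.1 hs
  have hlog : ∀ v, |v| ≤ 4 * T → Real.log ‖U v‖ ≤ 17 * T ^ 2 * h v := by
    intro v hv
    have hv2 : 1 + v ^ 2 ≤ 17 * T ^ 2 := by
      have := (sq_le_sq₀ (abs_nonneg v) (by linarith)).2 hv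
      rw [sq_abs] at this
      nlinarith
    have hpos : 0 < 1 + v ^ 2 := by positivity
    calc Real.log ‖U v‖ ≤ (1 + v ^ 2) * h v := by
          simp only [hh, norm_div, Real.norm_eq_abs, abs_of_pos hpos]
          rw [mul_div_cancel₀ _ hpos.ne']
          exact le_abs_self _
      _ ≤ _ := mul_le_mul_of_nonneg_right hv2 (norm_nonneg _)
  have hpt : ∀ u ∈ Set.Icc (2 * T) (3 * T),
      Real.log ‖U s‖ ≤ 17 * T ^ 2 * (h u + h (s - u)) := by
    intro u hu
    have h1 := hlog u (abs_le.2 ⟨by linarith [hu.1], by linarith [hu.2]⟩)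
    have h2 := hlog (s - u) (abs_le.2 ⟨by linarith [hu.2], by linarith [hu.1]⟩)
    have h3 := hU.log_norm_add_le u (s - u)
    rw [add_sub_cancel] at h3
    linarith
  have hle : 2 * T ≤ 3 * T := by linarith
  have hmono := intervalIntegral.integral_mono_on hle
    (f := fun _ => Real.log ‖U s‖) intervalIntegrable_const
    (((hinteg.add (hinteg.comp_sub_left s)).const_mul (17 * T ^ 2)).intervalIntegrable) hpt
  have hset : MeasurableSet {v : ℝ | T ≤ |v| ∧ |v| < 4 * T} :=
    (measurableSet_le measurable_const measurable_norm).inter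
      (measurableSet_lt measurable_norm measurable_const)
  have hsub : ∀ a b : ℝ, a ≤ b → Set.Ioc a b ⊆ {v : ℝ | T ≤ |v| ∧ |v| < 4 * T} →
      ∫ v in a..b, h v ≤ ∫ v in {v : ℝ | T ≤ |v| ∧ |v| < 4 * T}, h v := by
    intro a b hab hsub
    rw [intervalIntegral.integral_of_le hab]
    exact setIntegral_mono_set hinteg.integrableOn
      (Filter.Eventually.of_forall fun v => norm_nonneg _) hsub.eventuallyLE
  have hI₁ := hsub (2 * T) (3 * T) hle fun v hv => by
    have : |v| = v := abs_of_pos (by linarith [hv.1])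
    rw [Set.mem_ofPred_eq, this]
    exact ⟨by linarith [hv.1], by linarith [hv.2]⟩
  have hI₂ := hsub (s - 3 * T) (s - 2 * T) (by linarith) fun v hv => by
    have : |v| = -v := abs_of_neg (by linarith [hv.2])
    rw [Set.mem_ofPred_eq, this]
    exact ⟨by linarith [hv.2], by linarith [hv.1]⟩
  rw [intervalIntegral.integral_const, intervalIntegral.integral_const_mul] at hmono
  simp only [Pi.add_apply] at hmono
  rw [intervalIntegral.integral_add hinteg.intervalIntegrable
    (hinteg.comp_sub_left s).intervalIntegrable, intervalIntegral.integral_comp_sub_left,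
    smul_eq_mul] at hmono
  set I := ∫ v in {v : ℝ | T ≤ |v| ∧ |v| < 4 * T}, h v
  have hT0 : 0 < T := by linarith
  have : T * Real.log ‖U s‖ ≤ T * (34 * T * I) := by
    calc T * Real.log ‖U s‖ = (3 * T - 2 * T) * Real.log ‖U s‖ := by ring
      _ ≤ _ := hmono
      _ ≤ 17 * T ^ 2 * (I + I) := by gcongr
      _ = T * (34 * T * I) := by ring
  exact le_of_mul_le_mul_left this hT0

theorem summable_log_groupBound [Nontrivial X] (hU : IsC0Group U)
    (hqa : Integrable (fun t : ℝ => Real.log ‖U t‖ / (1 + t ^ 2))) :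
    Summable fun k : ℕ => Real.log (groupBound U (4 ^ k)) * (1 / 4) ^ k := by
  let A : ℕ → Set ℝ := fun k => {v : ℝ | 4 ^ k ≤ |v| ∧ |v| < 4 * 4 ^ k}
  have hA : ∀ k, MeasurableSet (A k) := fun k =>
    (measurableSet_le measurable_const measurable_norm).inter
      (measurableSet_lt measurable_norm measurable_const)
  have hlt : ∀ i j, i < j → Disjoint (A i) (A j) := by
    intro i j hij
    refine Set.disjoint_left.2 fun v hi hj => ?_
    have : (4 : ℝ) ^ (i + 1) ≤ 4 ^ j := pow_le_pow_right₀ (by norm_num) hij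
    rw [pow_succ] at this
    linarith [hi.2, hj.1]
  have hdisj : Pairwise (Function.onFun Disjoint A) := fun i j hij => by
    rcases lt_or_gt_of_ne hij with h | h
    · exact hlt i j h
    · exact (hlt j i h).symm
  have hsum := (hasSum_integral_iUnion hA hdisj hqa.norm.integrableOn).summable
  refine Summable.of_nonneg_of_le (fun k => ?_) (fun k => ?_) (hsum.mul_left 34)
  · exact mul_nonneg (Real.log_nonneg (hU.one_le_groupBound (by positivity))) (by positivity)
  · have hT : (1 : ℝ) ≤ 4 ^ k := one_le_pow₀ (by norm_num)
    have hlog : Real.log (groupBound U (4 ^ k)) ≤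
        34 * 4 ^ k * ∫ v in A k, ‖Real.log ‖U v‖ / (1 + v ^ 2)‖ := by
      rw [Real.log_le_iff_le_exp (one_pos.trans_le (hU.one_le_groupBound (by positivity)))]
      refine groupBound_le (by positivity) fun τ hτ => ?_
      rw [← Real.log_le_iff_le_exp (hU.norm_pos τ)]
      exact hU.log_norm_le_integral_annulus hqa hT hτ
    calc _ ≤ (34 * 4 ^ k * ∫ v in A k, ‖Real.log ‖U v‖ / (1 + v ^ 2)‖) * (1 / 4) ^ k := by
          gcongr
      _ = 34 * (∫ v in A k, ‖Real.log ‖U v‖ / (1 + v ^ 2)‖) * (4 * (1 / 4)) ^ k := by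
          rw [mul_pow]
          ring
      _ = _ := by norm_num

end IsC0Group

namespace ExpTypeLe

variable {U : ℝ → X →L[ℝ] X} {x y : X} {r : ℝ}

theorem zero (U : ℝ → X →L[ℝ] X) (hr : 0 ≤ r) : ExpTypeLe U 0 r := by
  refine ⟨fun _ => 0, rfl, fun n s => ?_, fun ρ hρ => ⟨1, one_pos, fun n => ?_⟩⟩
  · simpa using hasDerivAt_const s (0 : X)
  · have : 0 ≤ ρ := hr.trans hρ.le
    simpa using pow_nonneg this n

theorem add (hx : ExpTypeLe U x r) (hy : ExpTypeLe U y r) : ExpTypeLe U (x + y) r := by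
  obtain ⟨xs, rfl, hxs, hxb⟩ := hx
  obtain ⟨ys, rfl, hys, hyb⟩ := hy
  refine ⟨fun n => xs n + ys n, rfl, fun n s => ?_, fun ρ hρ => ?_⟩
  · simpa only [_root_.map_add] using! (hxs n s).add (hys n s)
  · obtain ⟨c, hc, hcb⟩ := hxb ρ hρ
    obtain ⟨d, hd, hdb⟩ := hyb ρ hρ
    refine ⟨c + d, add_pos hc hd, fun n => (norm_add_le _ _).trans ?_⟩
    rw [add_mul]
    exact add_le_add (hcb n) (hdb n)

theorem smul (hx : ExpTypeLe U x r) (a : ℝ) : ExpTypeLe U (a • x) r := by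
  obtain ⟨xs, rfl, hxs, hxb⟩ := hx
  refine ⟨fun n => a • xs n, rfl, fun n s => ?_, fun ρ hρ => ?_⟩
  · simpa only [_root_.map_smul] using! (hxs n s).const_smul a
  · obtain ⟨c, hc, hcb⟩ := hxb ρ hρ
    refine ⟨(|a| + 1) * c, by positivity, fun n => ?_⟩
    rw [norm_smul, Real.norm_eq_abs, mul_assoc]
    exact mul_le_mul (by linarith) (hcb n) (norm_nonneg _) (by positivity)

theorem sum {ι : Type*} (s : Finset ι) {z : ι → X} (hr : 0 ≤ r)
    (hz : ∀ i ∈ s, ExpTypeLe U (z i) r) : ExpTypeLe U (∑ i ∈ s, z i) r := by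
  classical
  induction s using Finset.induction_on with
  | empty => simpa using zero U hr
  | insert i s hi ih =>
    rw [Finset.sum_insert hi]
    exact (hz i (Finset.mem_insert_self i s)).add
      (ih fun j hj => hz j (Finset.mem_insert_of_mem hj))

end ExpTypeLe

theorem inv_one_add_sq_sub_le {t u : ℝ} (hu : |u| ≤ 1) :
    (1 + (t - u) ^ 2)⁻¹ ≤ 3 * (1 + t ^ 2)⁻¹ := by
  have hu2 : u ^ 2 ≤ 1 := (sq_le_one_iff_abs_le_one u).2 hu
  rw [← div_eq_mul_inv, inv_eq_one_div, div_le_div_iff₀ (by positivity) (by positivity)]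
  nlinarith [sq_nonneg (t - 2 * u), sq_nonneg (t - u)]

namespace IsC0Group

variable {U : ℝ → X →L[ℝ] X}

theorem integrable_smul_orbit (hU : IsC0Group U) {f : ℝ → ℝ} {C : ℝ} (hf : Continuous f)
    (hC : ∀ t, |f t| * ‖U t‖ ≤ C * (1 + t ^ 2)⁻¹) (x : X) :
    Integrable fun t => f t • U t x := by
  refine ((integrable_inv_one_add_sq.const_mul C).mul_const ‖x‖).mono'
    (hf.smul (hU.cont x)).aestronglyMeasurable (Filter.Eventually.of_forall fun t => ?_)
  rw [norm_smul, Real.norm_eq_abs]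
  calc |f t| * ‖U t x‖ ≤ |f t| * (‖U t‖ * ‖x‖) := by
        gcongr
        exact (U t).le_opNorm x
    _ = |f t| * ‖U t‖ * ‖x‖ := by ring
    _ ≤ _ := by
        exact mul_le_mul_of_nonneg_right (hC t) (norm_nonneg x)

theorem norm_mul_shift_le (hU : IsC0Group U) {f : ℝ → ℝ} {C u : ℝ} (hu : |u| ≤ 1)
    (hC : ∀ t, |f t| * ‖U t‖ ≤ C * (1 + t ^ 2)⁻¹) (t : ℝ) :
    |f (t - u)| * ‖U t‖ ≤ 3 * groupBound U 1 * C * (1 + t ^ 2)⁻¹ := by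
  have hB := hU.norm_le_groupBound hu
  have hB0 : 0 ≤ groupBound U 1 := (norm_nonneg _).trans hB
  have hC0 : 0 ≤ C := by
    have := (mul_nonneg (abs_nonneg _) (norm_nonneg _)).trans (hC 0)
    simpa using this
  have hsplit : ‖U t‖ ≤ ‖U (t - u)‖ * groupBound U 1 := by
    calc ‖U t‖ = ‖U (t - u) * U u‖ := by rw [← hU.map_add_mul, sub_add_cancel]
      _ ≤ ‖U (t - u)‖ * ‖U u‖ := norm_mul_le _ _
      _ ≤ _ := by gcongr
  calc |f (t - u)| * ‖U t‖ ≤ |f (t - u)| * (‖U (t - u)‖ * groupBound U 1) := by gcongr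
    _ = |f (t - u)| * ‖U (t - u)‖ * groupBound U 1 := by ring
    _ ≤ C * (1 + (t - u) ^ 2)⁻¹ * groupBound U 1 := by
        exact mul_le_mul_of_nonneg_right (hC (t - u)) hB0
    _ ≤ C * (3 * (1 + t ^ 2)⁻¹) * groupBound U 1 := by
        gcongr
        exact inv_one_add_sq_sub_le hu
    _ = _ := by ring

theorem map_integral_smul_orbit (hU : IsC0Group U) {f : ℝ → ℝ} {C : ℝ} (hf : Continuous f)
    (hC : ∀ t, |f t| * ‖U t‖ ≤ C * (1 + t ^ 2)⁻¹) (x : X) (s : ℝ) :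
    U s (∫ t, f t • U t x) = ∫ t, f (t - s) • U t x := by
  rw [← (U s).integral_comp_comm (hU.integrable_smul_orbit hf hC x),
    ← integral_sub_right_eq_self _ s]
  refine integral_congr_ae (Filter.Eventually.of_forall fun t => ?_)
  simp only [_root_.map_smul]
  rw [← ContinuousLinearMap.comp_apply, ← hU.map_add, add_sub_cancel]

/-- The mean of an orbit against a smooth kernel of exponential type `b`, dominated with its
derivatives by the weight of the group, is a vector of exponential type at most `b`. -/
theorem expTypeLe_integral_smul_orbit (hU : IsC0Group U) {f : ℝ → ℝ} {b r C : ℝ}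
    (hf : ContDiff ℝ ∞ f) (hb : 0 ≤ b) (hbr : b ≤ r)
    (hC : ∀ n t, |iteratedDeriv n f t| * ‖U t‖ ≤ b ^ n * C * (1 + t ^ 2)⁻¹) (x : X) :
    ExpTypeLe U (∫ t, f t • U t x) r := by
  have hcont : ∀ n, Continuous (iteratedDeriv n f) := fun n =>
    hf.continuous_iteratedDeriv n (by exact_mod_cast (ENat.natCast_lt_top n).le)
  have hderiv_zero : ∀ n, HasDerivAt (fun s => U s ((-1 : ℝ) ^ n • ∫ t, iteratedDeriv n f t • U t x))
      ((-1 : ℝ) ^ (n + 1) • ∫ t, iteratedDeriv (n + 1) f t • U t x) 0 := by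
    intro n
    have hD := (hasDerivAt_integral_of_dominated_loc_of_deriv_le (μ := volume) (x₀ := (0 : ℝ))
      (s := Metric.ball 0 1) (F := fun s t => iteratedDeriv n f (t - s) • U t x)
      (F' := fun s t => (-iteratedDeriv (n + 1) f (t - s)) • U t x)
      (bound := fun t => 3 * groupBound U 1 * (b ^ (n + 1) * C) * (1 + t ^ 2)⁻¹ * ‖x‖)
      (Metric.ball_mem_nhds 0 one_pos) ?_ ?_ ?_ ?_ ?_ ?_).2
    · have h := hD.const_smul ((-1 : ℝ) ^ n)
      have hfun : (fun s => U s ((-1 : ℝ) ^ n • ∫ t, iteratedDeriv n f t • U t x)) =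
          fun s => (-1 : ℝ) ^ n • ∫ t, iteratedDeriv n f (t - s) • U t x := by
        funext s
        rw [_root_.map_smul, hU.map_integral_smul_orbit (hcont n) (hC n)]
      rw [hfun]
      refine h.congr_deriv ?_
      simp only [sub_zero, neg_smul]
      rw [integral_neg, pow_succ, mul_smul, neg_one_smul]
    · exact Filter.Eventually.of_forall fun s =>
        (((hcont n).comp (by fun_prop)).smul (hU.cont x)).aestronglyMeasurable
    · simpa using hU.integrable_smul_orbit (hcont n) (hC n) x
    · exact (((hcont (n + 1)).comp (by fun_prop)).neg.smul (hU.cont x)).aestronglyMeasurable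
    · refine Filter.Eventually.of_forall fun t s hs => ?_
      have hs1 : |s| ≤ 1 := by simpa using (mem_ball_zero_iff.1 hs).le
      rw [norm_smul, norm_neg, Real.norm_eq_abs]
      calc _ ≤ |iteratedDeriv (n + 1) f (t - s)| * (‖U t‖ * ‖x‖) := by
            gcongr
            exact (U t).le_opNorm x
        _ = |iteratedDeriv (n + 1) f (t - s)| * ‖U t‖ * ‖x‖ := by ring
        _ ≤ _ := by
            exact mul_le_mul_of_nonneg_right (hU.norm_mul_shift_le hs1 (hC (n + 1)) t)
              (norm_nonneg x)
    · exact (integrable_inv_one_add_sq.const_mul _).mul_const _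
    · refine Filter.Eventually.of_forall fun t s _ => ?_
      have h := (hasDerivAt_iteratedDeriv hf n (t - s)).scomp s ((hasDerivAt_id s).const_sub t)
      exact (h.congr_deriv (by simp)).smul_const (U t x)
  refine ⟨fun n => (-1 : ℝ) ^ n • ∫ t, iteratedDeriv n f t • U t x, by simp, fun n s => ?_,
    fun ρ hρ => ?_⟩
  · have hshift : HasDerivAt (fun t : ℝ => t - s) 1 s := (hasDerivAt_id s).sub_const s
    have h0 : HasDerivAt (fun s => U s ((-1 : ℝ) ^ n • ∫ t, iteratedDeriv n f t • U t x))
      ((-1 : ℝ) ^ (n + 1) • ∫ t, iteratedDeriv (n + 1) f t • U t x) (s - s) := by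
      rw [sub_self]
      exact hderiv_zero n
    have h := (U s).hasFDerivAt.comp_hasDerivAt s (HasDerivAt.scomp (h := fun t => t - s) s h0 hshift)
    rw [one_smul] at h
    refine h.congr_of_eventuallyEq (Filter.Eventually.of_forall fun t => ?_)
    simp only [Function.comp_apply]
    rw [← ContinuousLinearMap.comp_apply, ← hU.map_add, add_sub_cancel]
  · have hC0 : 0 ≤ C := by
      have := (mul_nonneg (abs_nonneg _) (norm_nonneg _)).trans (hC 0 0)
      simpa using this
    have hI0 : 0 ≤ ∫ t : ℝ, (1 + t ^ 2)⁻¹ := integral_nonneg fun t => by positivity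
    refine ⟨C * ‖x‖ * (∫ t : ℝ, (1 + t ^ 2)⁻¹) + 1, by positivity, fun n => ?_⟩
    rw [norm_smul, norm_pow, norm_neg, norm_one, one_pow, one_mul]
    have hle : ‖∫ t, iteratedDeriv n f t • U t x‖ ≤
        ∫ t : ℝ, b ^ n * C * ‖x‖ * (1 + t ^ 2)⁻¹ := by
      refine norm_integral_le_of_norm_le (integrable_inv_one_add_sq.const_mul _)
        (Filter.Eventually.of_forall fun t => ?_)
      rw [norm_smul, Real.norm_eq_abs]
      calc _ ≤ |iteratedDeriv n f t| * (‖U t‖ * ‖x‖) := by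
            gcongr
            exact (U t).le_opNorm x
        _ = |iteratedDeriv n f t| * ‖U t‖ * ‖x‖ := by ring
        _ ≤ b ^ n * C * (1 + t ^ 2)⁻¹ * ‖x‖ := by
            exact mul_le_mul_of_nonneg_right (hC n t) (norm_nonneg x)
        _ = _ := by ring
    rw [integral_const_mul] at hle
    have hpow : b ^ n ≤ ρ ^ n := pow_le_pow_left₀ hb (hbr.trans hρ.le) n
    have hρn : 0 ≤ ρ ^ n := (pow_nonneg hb n).trans hpow
    calc _ ≤ _ := hle
      _ = b ^ n * (C * ‖x‖ * ∫ t : ℝ, (1 + t ^ 2)⁻¹) := by ring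
      _ ≤ ρ ^ n * (C * ‖x‖ * ∫ t : ℝ, (1 + t ^ 2)⁻¹) := by gcongr
      _ ≤ _ := by rw [mul_comm, add_mul]; linarith

theorem comp_mul (hU : IsC0Group U) (a : ℝ) : IsC0Group fun t => U (a * t) where
  map_zero := by simp [hU.map_zero]
  map_add s t := by rw [mul_add, hU.map_add]
  cont x := (hU.cont x).comp (continuous_const.mul continuous_id)

theorem norm_pow_sub_one_apply_le_symModulus [Nontrivial X] (hU : IsC0Group U) (m : ℕ) (x : X)
    {τ T : ℝ} (hτ : |τ| ≤ T) : ‖((U τ - 1) ^ m) x‖ ≤ symModulus U m T x := by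
  refine le_csSup ⟨(groupBound U T + 1) ^ m * ‖x‖, ?_⟩ ⟨τ, hτ, rfl⟩
  rintro _ ⟨σ, hσ, rfl⟩
  refine (ContinuousLinearMap.le_opNorm _ x).trans ?_
  gcongr
  refine (norm_pow_le _ m).trans ?_
  gcongr
  refine (norm_sub_le _ _).trans ?_
  rw [norm_one]
  gcongr
  exact hU.norm_le_groupBound hσ

theorem norm_pow_sub_one_apply_le [Nontrivial X] (hU : IsC0Group U) (m : ℕ) (x : X)
    {r : ℝ} (hr : 0 < r) (t : ℝ) :
    ‖((U t - 1) ^ m) x‖ ≤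
      ((1 + r * |t|) * groupBound U |t|) ^ m * symModulus U m (1 / r) x := by
  set N : ℕ := ⌊r * |t|⌋₊ + 1 with hN
  have hNpos : (0 : ℝ) < N := by positivity
  have hB0 : 0 ≤ groupBound U |t| := (norm_nonneg _).trans (hU.norm_le_groupBound le_rfl)
  have hτ : |t / N| ≤ 1 / r := by
    rw [abs_div, abs_of_pos hNpos, div_le_div_iff₀ hNpos hr, one_mul, mul_comm]
    simpa [hN] using (Nat.lt_floor_add_one (r * |t|)).le
  have hNle : (N : ℝ) ≤ 1 + r * |t| := by
    have := Nat.floor_le (mul_nonneg hr.le (abs_nonneg t))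
    push_cast [hN]
    linarith
  have hUt : U t = U (t / N) ^ N := by
    rw [← hU.map_nat_mul, mul_div_cancel₀ _ hNpos.ne']
  have hfactor : (U t - 1) ^ m =
      (∑ i ∈ Finset.range N, U (t / N) ^ i) ^ m * (U (t / N) - 1) ^ m := by
    rw [hUt, ← geom_sum_mul, Commute.mul_pow]
    exact ((Commute.sum_left _ _ _ fun i _ => (Commute.refl (U (t / N))).pow_left i)).sub_right
      (Commute.one_right _)
  have hsum : ‖∑ i ∈ Finset.range N, U (t / N) ^ i‖ ≤ N * groupBound U |t| := by
    refine (norm_sum_le_of_le _ (f := fun i => U (t / N) ^ i)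
      (n := fun _ => groupBound U |t|) fun i hi => ?_).trans (by simp)
    rw [← hU.map_nat_mul]
    refine hU.norm_le_groupBound ?_
    rw [abs_mul, abs_div, Nat.abs_cast, Nat.abs_cast, ← mul_div_assoc, div_le_iff₀ hNpos, mul_comm]
    have : (i : ℝ) ≤ N := by exact_mod_cast (Finset.mem_range.1 hi).le
    gcongr
  rw [hfactor, mul_apply_eq_comp]
  calc _ ≤ ‖(∑ i ∈ Finset.range N, U (t / N) ^ i) ^ m‖ * ‖((U (t / N) - 1) ^ m) x‖ :=
        ContinuousLinearMap.le_opNorm _ _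
    _ ≤ ((1 + r * |t|) * groupBound U |t|) ^ m * symModulus U m (1 / r) x := by
        gcongr
        · refine (norm_pow_le _ m).trans ?_
          gcongr
          exact hsum.trans (by gcongr)
        · exact hU.norm_pow_sub_one_apply_le_symModulus m x hτ

theorem norm_map_nat_mul_le [Nontrivial X] (hU : IsC0Group U) {j m : ℕ} (hj : j ≤ m) {r : ℝ}
    (hr : 1 ≤ r) (t : ℝ) :
    ‖U (j * t)‖ ≤ ((1 + |r * t|) * groupBound U |r * t|) ^ m := by
  have hB1 : 1 ≤ groupBound U |r * t| := hU.one_le_groupBound (abs_nonneg _)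
  have hle : |t| ≤ |r * t| := by
    rw [abs_mul]
    exact le_mul_of_one_le_left (abs_nonneg t) (hr.trans (le_abs_self r))
  have hB : groupBound U |r * t| ≤ (1 + |r * t|) * groupBound U |r * t| :=
    le_mul_of_one_le_left (by linarith) (by linarith [abs_nonneg (r * t)])
  rw [hU.map_nat_mul]
  calc ‖U t ^ j‖ ≤ ‖U t‖ ^ j := norm_pow_le _ j
    _ ≤ ((1 + |r * t|) * groupBound U |r * t|) ^ j := by
        gcongr
        exact (hU.norm_le_groupBound hle).trans hB
    _ ≤ _ := pow_le_pow_right₀ (hB1.trans hB) hj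

theorem expTypeLe_kernel_mean [Nontrivial X] (hU : IsC0Group U) {K : ℝ → ℝ} {C : ℝ} {m : ℕ}
    (hK : ContDiff ℝ ∞ K) (hC : 0 < C)
    (hbound : ∀ n t,
      |iteratedDeriv n K t| * ((1 + |t|) * groupBound U |t|) ^ m ≤ C * (1 + t ^ 2)⁻¹)
    {j : ℕ} (hj : 1 ≤ j) (hjm : j ≤ m) {r : ℝ} (hr : 1 ≤ r) (x : X) :
    ExpTypeLe U (∫ t, (r * K (r * t)) • U (j * t) x) r := by
  have hj0 : (0 : ℝ) < j := by exact_mod_cast hj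
  have hjm' : (j : ℝ) ≤ m := by exact_mod_cast hjm
  have hj1 : (1 : ℝ) ≤ j := by exact_mod_cast hj
  set a : ℝ := r / j with ha
  have ha0 : 0 < a := div_pos (by linarith) hj0
  have haj : a * j = r := div_mul_cancel₀ r hj0.ne'
  have hchange : ∫ t, (r * K (r * t)) • U (j * t) x = ∫ t, (a * K (a * t)) • U t x := by
    have h := Measure.integral_comp_mul_left (fun t => (a * K (a * t)) • U t x) (j : ℝ)
    rw [abs_of_pos (inv_pos.2 hj0), eq_inv_smul_iff₀ hj0.ne', ← integral_smul] at h
    rw [← h]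
    refine integral_congr_ae (Filter.Eventually.of_forall fun t => ?_)
    simp only [smul_smul]
    rw [← haj]
    ring_nf
  rw [hchange]
  have hsmooth : ContDiff ℝ ∞ fun t => K (a * t) := hK.comp (by fun_prop)
  refine hU.expTypeLe_integral_smul_orbit (b := a) (C := a * C * m ^ 2)
    (contDiff_const.mul hsmooth) ha0.le (div_le_self (by linarith) hj1) (fun n t => ?_) x
  rw [iteratedDeriv_const_mul_field, iteratedDeriv_comp_const_mul
    (hK.of_le (by exact_mod_cast (ENat.natCast_lt_top n).le)), abs_mul, abs_mul,
    abs_of_pos ha0, abs_of_pos (pow_pos ha0 n)]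
  have hUt : ‖U t‖ ≤ ((1 + |a * t|) * groupBound U |a * t|) ^ m := by
    have h := hU.norm_map_nat_mul_le hjm hr (t / j)
    rwa [mul_div_cancel₀ _ hj0.ne', show r * (t / j) = a * t by rw [ha]; ring] at h
  have hdecay : (1 + (a * t) ^ 2)⁻¹ ≤ (m : ℝ) ^ 2 * (1 + t ^ 2)⁻¹ := by
    rw [← div_eq_mul_inv, inv_eq_one_div, div_le_div_iff₀ (by positivity) (by positivity), one_mul]
    have hma : (1 : ℝ) ≤ (m * a) ^ 2 := one_le_pow₀ (by nlinarith)
    have hm1 : (1 : ℝ) ≤ m ^ 2 := one_le_pow₀ (hj1.trans hjm')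
    calc 1 + t ^ 2 ≤ (m : ℝ) ^ 2 + (m * a) ^ 2 * t ^ 2 := by nlinarith [sq_nonneg t]
      _ = _ := by ring
  calc _ = a ^ n * a * (|iteratedDeriv n K (a * t)| * ‖U t‖) := by ring
    _ ≤ a ^ n * a * (C * (m ^ 2 * (1 + t ^ 2)⁻¹)) := by
        refine mul_le_mul_of_nonneg_left ?_ (by positivity)
        calc _ ≤ |iteratedDeriv n K (a * t)| * ((1 + |a * t|) * groupBound U |a * t|) ^ m := by
              gcongr
          _ ≤ C * (1 + (a * t) ^ 2)⁻¹ := hbound n (a * t)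
          _ ≤ _ := by gcongr
    _ = _ := by ring

theorem bestApprox_le {x y : X} {r : ℝ} (hy : ExpTypeLe U y r) : bestApprox U x r ≤ ‖x - y‖ := by
  refine csInf_le ⟨0, ?_⟩ ⟨y, hy, rfl⟩
  rintro _ ⟨z, -, rfl⟩
  exact norm_nonneg _

/-- The abstract Jackson inequality for the generator of a non-quasianalytic group. -/
theorem exists_jackson_constant [Nontrivial X] (hU : IsC0Group U)
    (hqa : Integrable (fun t : ℝ => Real.log ‖U t‖ / (1 + t ^ 2))) (m : ℕ) :
    ∃ c : ℝ, 0 < c ∧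
      ∀ (x : X) (r : ℝ), 1 ≤ r → bestApprox U x r ≤ c * symModulus U m (1 / r) x := by
  obtain ⟨K, C, hK, hK0, hK1, hC, hbound⟩ := exists_kernel
    (fun t ht => hU.one_le_groupBound ht) (fun s t hs hst => hU.groupBound_mono hs hst)
    (hU.summable_log_groupBound hqa) m
  refine ⟨C * Real.pi, by positivity, fun x r hr => ?_⟩
  have hr0 : 0 < r := by linarith
  set k : ℝ → ℝ := fun t => r * K (r * t) with hk
  have hk0 : ∀ t, 0 ≤ k t := fun t => mul_nonneg hr0.le (hK0 _)
  have hkc : Continuous k := continuous_const.mul (hK.continuous.comp (by fun_prop))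
  have hk1 : ∫ t, k t = 1 := by
    rw [integral_const_mul, Measure.integral_comp_mul_left, hK1, abs_of_pos (inv_pos.2 hr0)]
    simp [hr0.ne']
  have hkW : ∀ t, k t * ((1 + |r * t|) * groupBound U |r * t|) ^ m ≤
      r * C * (1 + (r * t) ^ 2)⁻¹ := by
    intro t
    have h := hbound 0 (r * t)
    rw [iteratedDeriv_zero, abs_of_nonneg (hK0 _)] at h
    simp only [hk, mul_assoc]
    gcongr
  have hinteg : ∀ j ≤ m, Integrable fun t => k t • U (j * t) x := by
    intro j hj
    refine (hU.comp_mul j).integrable_smul_orbit (C := r * C) hkc (fun t => ?_) x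
    rw [abs_of_nonneg (hk0 t)]
    calc _ ≤ k t * ((1 + |r * t|) * groupBound U |r * t|) ^ m :=
          mul_le_mul_of_nonneg_left (hU.norm_map_nat_mul_le hj hr t) (hk0 t)
      _ ≤ r * C * (1 + (r * t) ^ 2)⁻¹ := hkW t
      _ ≤ _ := by
          have h : t ^ 2 ≤ (r * t) ^ 2 := by
            rw [mul_pow]
            exact le_mul_of_one_le_left (sq_nonneg t) (one_le_pow₀ hr)
          exact mul_le_mul_of_nonneg_left (inv_anti₀ (by positivity) (by linarith)) (by positivity)
  let e : ℕ → ℝ := fun j => (-1) ^ (m - j) * m.choose j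
  have hexpand : ∀ t, k t • ((U t - 1) ^ m) x =
      ∑ j ∈ Finset.range (m + 1), e j • (k t • U (j * t) x) := by
    intro t
    have hpow : (U t - 1) ^ m = ∑ j ∈ Finset.range (m + 1), e j • U (j * t) := by
      rw [sub_eq_add_neg, (Commute.one_right (U t)).neg_right.add_pow]
      refine Finset.sum_congr rfl fun j _ => ?_
      have hneg : (-1 : X →L[ℝ] X) ^ (m - j) = algebraMap ℝ (X →L[ℝ] X) ((-1) ^ (m - j)) := by simp
      have hchoose : (m.choose j : X →L[ℝ] X) = algebraMap ℝ (X →L[ℝ] X) (m.choose j) := by simp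
      rw [hU.map_nat_mul, hneg, hchoose, mul_assoc, ← map_mul, ← Algebra.commutes, Algebra.smul_def]
    rw [hpow, sum_apply, Finset.smul_sum]
    refine Finset.sum_congr rfl fun j _ => ?_
    rw [smul_apply, smul_comm]
  have hmean : ∫ t, k t • ((U t - 1) ^ m) x =
      ∑ j ∈ Finset.range m, e (j + 1) • (∫ t, k t • U ((j + 1 : ℕ) * t) x) + (-1 : ℝ) ^ m • x := by
    simp_rw [hexpand]
    rw [integral_finsetSum (Finset.range (m + 1)) (f := fun j t => e j • (k t • U (j * t) x))
      fun j hj => (hinteg j (Nat.lt_succ_iff.1 (Finset.mem_range.1 hj))).smul (e j)]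
    simp_rw [integral_smul]
    rw [Finset.sum_range_succ']
    congr 2
    · simp [e]
    · simp only [Nat.cast_zero, zero_mul, hU.map_zero, one_apply_eq_self]
      rw [integral_smul_const, hk1, one_smul]
  set S := ∑ j ∈ Finset.range m, e (j + 1) • (∫ t, k t • U ((j + 1 : ℕ) * t) x) with hS
  have hStype : ExpTypeLe U S r := ExpTypeLe.sum _ hr0.le fun j hj =>
    (hU.expTypeLe_kernel_mean hK hC hbound (Nat.succ_pos j) (Finset.mem_range.1 hj) hr x).smul _
  have hsign : ((-1 : ℝ) ^ m) * (-1) ^ m = 1 := by rw [← mul_pow]; simp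
  have hdiff : x - (-(-1 : ℝ) ^ m) • S = (-1 : ℝ) ^ m • ∫ t, k t • ((U t - 1) ^ m) x := by
    rw [hmean, smul_add, smul_smul, hsign, one_smul, neg_smul, sub_neg_eq_add, add_comm]
  refine (bestApprox_le (hStype.smul (-(-1 : ℝ) ^ m))).trans ?_
  rw [hdiff, norm_smul, norm_pow, norm_neg, norm_one, one_pow, one_mul]
  have hω0 : 0 ≤ symModulus U m (1 / r) x := Real.sSup_nonneg (by
    rintro _ ⟨τ, -, rfl⟩
    exact norm_nonneg _)
  have hle : ‖∫ t, k t • ((U t - 1) ^ m) x‖ ≤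
      ∫ t, r * C * symModulus U m (1 / r) x * (1 + (r * t) ^ 2)⁻¹ := by
    refine norm_integral_le_of_norm_le
      ((integrable_inv_one_add_sq.comp_mul_left' hr0.ne').const_mul _)
      (Filter.Eventually.of_forall fun t => ?_)
    rw [norm_smul, Real.norm_of_nonneg (hk0 t)]
    have hrt : |r * t| = r * |t| := by rw [abs_mul, abs_of_pos hr0]
    have htle : |t| ≤ |r * t| := by
      rw [hrt]
      exact le_mul_of_one_le_left (abs_nonneg t) hr
    have hB0 : 0 ≤ groupBound U |t| := zero_le_one.trans (hU.one_le_groupBound (abs_nonneg t))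
    have hB := hU.groupBound_mono (abs_nonneg t) htle
    calc k t * ‖((U t - 1) ^ m) x‖
        ≤ k t * (((1 + r * |t|) * groupBound U |t|) ^ m * symModulus U m (1 / r) x) :=
          mul_le_mul_of_nonneg_left (hU.norm_pow_sub_one_apply_le m x hr0 t) (hk0 t)
      _ ≤ k t * (((1 + |r * t|) * groupBound U |r * t|) ^ m * symModulus U m (1 / r) x) := by
          have := hk0 t
          rw [← hrt]
          gcongr
      _ = k t * ((1 + |r * t|) * groupBound U |r * t|) ^ m * symModulus U m (1 / r) x := by ring
      _ ≤ r * C * (1 + (r * t) ^ 2)⁻¹ * symModulus U m (1 / r) x :=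
          mul_le_mul_of_nonneg_right (hkW t) hω0
      _ = _ := by ring
  refine hle.trans (le_of_eq ?_)
  rw [integral_const_mul, Measure.integral_comp_mul_left (fun t => (1 + t ^ 2)⁻¹),
    integral_univ_inv_one_add_sq, abs_of_pos (inv_pos.2 hr0), smul_eq_mul]
  field_simp

/-- The modulus of continuity of a vector in the domain of the `m`-th power of the generator. -/
theorem norm_pow_sub_one_apply_le_of_chain (hU : IsC0Group U) {m : ℕ} {xs : ℕ → X}
    (hxs : ∀ n < m, ∀ s : ℝ, HasDerivAt (fun t : ℝ => U t (xs n)) (U s (xs (n + 1))) s)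
    {τ T : ℝ} (hτ : |τ| ≤ T) (k n : ℕ) (hkn : n + k ≤ m) :
    ‖((U τ - 1) ^ k) (xs n)‖ ≤ (T * groupBound U T) ^ k * ‖xs (n + k)‖ := by
  induction k generalizing n with
  | zero => simp
  | succ k ih =>
    have hB0 : 0 ≤ groupBound U T := (norm_nonneg _).trans (hU.norm_le_groupBound hτ)
    have hT : 0 ≤ T := (abs_nonneg τ).trans hτ
    have ih' := ih (n + 1) (by omega)
    rw [add_right_comm] at ih'
    have hcomm : ∀ s, ((U τ - 1) ^ k) (U s (xs (n + 1))) = U s (((U τ - 1) ^ k) (xs (n + 1))) := by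
      intro s
      have h : Commute ((U τ - 1) ^ k) (U s) :=
        ((hU.commute τ s).sub_left (Commute.one_left _)).pow_left k
      exact congrArg (fun B : X →L[ℝ] X => B (xs (n + 1))) h
    have hmv := (convex_uIcc 0 τ).norm_image_sub_le_of_norm_hasDerivWithin_le
      (f := fun s => ((U τ - 1) ^ k) (U s (xs n)))
      (f' := fun s => ((U τ - 1) ^ k) (U s (xs (n + 1))))
      (C := groupBound U T * ((T * groupBound U T) ^ k * ‖xs (n + k + 1)‖))
      (fun s _ => (((U τ - 1) ^ k).hasFDerivAt.comp_hasDerivAt s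
        (hxs n (by omega) s)).hasDerivWithinAt)
      (fun s hs => by
        have hs' : |s| ≤ T := by
          have := Set.abs_sub_left_of_mem_uIcc hs
          rw [sub_zero, sub_zero] at this
          exact this.trans hτ
        rw [hcomm]
        refine (ContinuousLinearMap.le_opNorm _ _).trans ?_
        gcongr
        exact hU.norm_le_groupBound hs') Set.left_mem_uIcc Set.right_mem_uIcc
    have heq : ((U τ - 1) ^ (k + 1)) (xs n) =
        ((U τ - 1) ^ k) (U τ (xs n)) - ((U τ - 1) ^ k) (U 0 (xs n)) := by
      rw [pow_succ, mul_apply_eq_comp, ← map_sub, hU.map_zero]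
      rfl
    rw [heq]
    refine hmv.trans ?_
    rw [sub_zero, Real.norm_eq_abs]
    calc _ ≤ groupBound U T * ((T * groupBound U T) ^ k * ‖xs (n + k + 1)‖) * T := by gcongr
      _ = _ := by
        rw [← add_assoc n k 1]
        ring

end IsC0Group

/-- Jackson inequality for x ∈ D(A^m): with m_m the constant from the abstract
Jackson inequality (Theorem 1 with k = m), for all x ∈ D(A^m) (witnessed by the
chain xs, A^m x = xs m) and r ≥ 1:
E_r(x,A) ≤ (m_m/r^m)·(M_U(1/r))^m·‖A^m x‖. -/
theorem stmt_19 {X : Type*} [NormedAddCommGroup X] [NormedSpace ℝ X] [CompleteSpace X]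
    (U : ℝ → X →L[ℝ] X) (hU : IsC0Group U)
    (hqa : Integrable (fun t : ℝ => Real.log ‖U t‖ / (1 + t ^ 2)))
    (m : ℕ) (hm : 1 ≤ m) :
    ∃ c : ℝ, 0 < c ∧
      (∀ (x : X) (r : ℝ), 1 ≤ r → bestApprox U x r ≤ c * symModulus U m (1 / r) x) ∧
      ∀ (x : X) (xs : ℕ → X), xs 0 = x →
        (∀ n < m, ∀ s : ℝ, HasDerivAt (fun t : ℝ => U t (xs n)) (U s (xs (n + 1))) s) →
        ∀ r : ℝ, 1 ≤ r →
          bestApprox U x r ≤ c / r ^ m * (groupBound U (1 / r)) ^ m * ‖xs m‖ := by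
  have hsym0 : ∀ (x : X) (r : ℝ), 0 ≤ symModulus U m (1 / r) x := fun x r => Real.sSup_nonneg (by
    rintro _ ⟨τ, -, rfl⟩
    exact norm_nonneg _)
  obtain ⟨c, hc, hjackson⟩ : ∃ c : ℝ, 0 < c ∧
      ∀ (x : X) (r : ℝ), 1 ≤ r → bestApprox U x r ≤ c * symModulus U m (1 / r) x := by
    rcases subsingleton_or_nontrivial X with hX | hX
    · refine ⟨1, one_pos, fun x r hr => ?_⟩
      refine (IsC0Group.bestApprox_le (ExpTypeLe.zero U (by linarith))).trans ?_
      rw [Subsingleton.elim (x - 0) 0, norm_zero, one_mul]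
      exact hsym0 x r
    · exact hU.exists_jackson_constant hqa m
  refine ⟨c, hc, hjackson, ?_⟩
  rintro _ xs rfl hxs r hr
  have hr0 : 0 < r := by linarith
  have hmod : symModulus U m (1 / r) (xs 0) ≤ (1 / r * groupBound U (1 / r)) ^ m * ‖xs m‖ := by
    refine csSup_le ⟨_, 0, by simpa using hr0.le, rfl⟩ ?_
    rintro _ ⟨τ, hτ, rfl⟩
    simpa only [zero_add] using
      hU.norm_pow_sub_one_apply_le_of_chain hxs hτ m 0 (by omega)
  calc bestApprox U (xs 0) r ≤ c * symModulus U m (1 / r) (xs 0) := hjackson _ r hr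
    _ ≤ c * ((1 / r * groupBound U (1 / r)) ^ m * ‖xs m‖) := by gcongr
    _ = c / r ^ m * (groupBound U (1 / r)) ^ m * ‖xs m‖ := by
        rw [mul_pow, div_pow, one_pow]
        ring
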